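/- Let L ⊆ ℤ^m be a lattice with dim(L) < (m − 4)/3. Then there exist indices i, j ∈ {1, …, m} with i ≠ j such that, setting c := e_j − e_i (a slanted edge generator of the corner cone C_i), one has L ∩ C_i = {0} and (L + ⟨c⟩) ∩ C_i = [c], where L + ⟨c⟩ = {ℓ + α·c : ℓ ∈ L, α ∈ ℤ} and [c] = {β·c : β ∈ ℕ}. -/

import Mathlib

/-- The cone generated by the vectors `c 1, …, c n`: all `ℕ`-linear combinations. -/
def coneGen {m n : ℕ} (c : Fin n → (Fin m → ℤ)) : Set (Fin m → ℤ) :=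
  { v | ∃ β : Fin n → ℕ, v = ∑ j, (β j : ℤ) • c j }

/-- `stdVec m 0 = e_0 = 0` and `stdVec m i = e_i` (the `i`-th standard unit vector)
for `i ∈ {1, …, m}`. -/
def stdVec (m : ℕ) (i : Fin (m + 1)) : Fin m → ℤ :=
  fun j => if (j : ℕ) + 1 = (i : ℕ) then 1 else 0

/-- The `i`-th corner cone `C_i = [e_0 - e_i, e_1 - e_i, …, e_m - e_i]` of the
standard simplex. -/
def cornerCone (m : ℕ) (i : Fin (m + 1)) : Set (Fin m → ℤ) :=
  coneGen (fun k : Fin (m + 1) => stdVec m k - stdVec m i)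

/-- The `ℝ`-vector space spanned by a lattice `L ⊆ ℤ^m`. -/
def latticeSpan {m : ℕ} (L : AddSubgroup (Fin m → ℤ)) : Submodule ℝ (Fin m → ℝ) :=
  Submodule.span ℝ ((fun v : Fin m → ℤ => (fun j => (v j : ℝ))) '' (L : Set (Fin m → ℤ)))

open Module in
/-- A spanning family of functionals on `W` with zero sum contains at most `2 * finrank W + 1`
members that cannot be simultaneously nonnegative at a nonzero point. -/
theorem exists_finset_card_le_forall_nonneg_imp_eq_zero {W ι : Type*} [AddCommGroup W] [Module ℝ W]
    [FiniteDimensional ℝ W] [Fintype ι] (f : ι → Dual ℝ W) (hsum : ∑ k, f k = 0)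
    (hcard : finrank ℝ W < Fintype.card ι) (hsep : ∀ x, (∀ k, f k x = 0) → x = 0) :
    ∃ S : Finset ι, S.card ≤ 2 * finrank ℝ W + 1 ∧ ∀ x, (∀ k ∈ S, 0 ≤ f k x) → x = 0 := by
  classical
  obtain ⟨κ, a, ha, hspan, hli⟩ := exists_linearIndependent' ℝ f
  have : Fintype κ := Fintype.ofInjective a ha
  have hκ : Fintype.card κ ≤ finrank ℝ W := by
    simpa [Subspace.dual_finrank_eq] using hli.fintype_card_le_finrank
  set B : Finset ι := Finset.univ.image a with hB
  have hBcard : B.card ≤ finrank ℝ W := Finset.card_image_le.trans hκ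
  have hBsep : ∀ x, (∀ k ∈ B, f k x = 0) → x = 0 := by
    intro x hx
    refine hsep x fun k => ?_
    have hle : Submodule.span ℝ (Set.range (f ∘ a)) ≤ LinearMap.ker (Dual.eval ℝ W x) := by
      rw [Submodule.span_le]
      rintro _ ⟨t, rfl⟩
      simpa using hx (a t) (by simp [hB])
    have hk := hle (hspan ▸ Submodule.subset_span ⟨k, rfl⟩ :
      f k ∈ Submodule.span ℝ (Set.range (f ∘ a)))
    simpa using hk
  have hpos : 0 < Bᶜ.card := by
    rw [Finset.card_compl]
    omega
  have hmem : ∑ k ∈ Bᶜ, (Bᶜ.card : ℝ)⁻¹ • f k ∈ convexHull ℝ (Set.range f) := by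
    refine (convex_convexHull ℝ _).sum_mem (fun _ _ => by positivity) ?_
      fun k _ => subset_convexHull ℝ _ ⟨k, rfl⟩
    rw [Finset.sum_const, nsmul_eq_mul]
    exact mul_inv_cancel₀ (by positivity)
  obtain ⟨τ, _, z, w, hz, haff, hw, -, hsumz⟩ := eq_pos_convex_span_of_mem_convexHull hmem
  choose g hg using fun t => hz ⟨t, rfl⟩
  have hτ : Fintype.card τ ≤ finrank ℝ W + 1 := by
    refine haff.card_le_finrank_succ.trans (Nat.succ_le_succ ?_)
    exact (Submodule.finrank_le _).trans Subspace.dual_finrank_eq.le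
  refine ⟨B ∪ Finset.univ.image g, ?_, fun x hx => hBsep x ?_⟩
  · have h₁ := Finset.card_union_le B (Finset.univ.image g)
    have h₂ : (Finset.univ.image g).card ≤ Fintype.card τ := Finset.card_image_le
    omega
  · have hBnonneg : ∀ k ∈ B, 0 ≤ f k x := fun k hk => hx k (Finset.mem_union_left _ hk)
    have hc : 0 ≤ ∑ k ∈ Bᶜ, (Bᶜ.card : ℝ)⁻¹ * f k x := by
      have h := congrArg (fun φ : Dual ℝ W => φ x) hsumz
      simp only [LinearMap.sum_apply, LinearMap.smul_apply, smul_eq_mul] at h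
      rw [← h]
      refine Finset.sum_nonneg fun t _ => mul_nonneg (hw t).le ?_
      rw [← hg t]
      exact hx _ (by simp)
    rw [← Finset.mul_sum] at hc
    have hc' : 0 ≤ ∑ k ∈ Bᶜ, f k x := nonneg_of_mul_nonneg_right hc (by positivity)
    have htot : ∑ k ∈ B, f k x + ∑ k ∈ Bᶜ, f k x = 0 := by
      rw [Finset.sum_add_sum_compl, ← LinearMap.sum_apply, hsum, LinearMap.zero_apply]
    have hzero : ∑ k ∈ B, f k x = 0 := by
      have := Finset.sum_nonneg hBnonneg
      linarith
    exact (Finset.sum_eq_zero_iff_of_nonneg hBnonneg).1 hzero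

theorem stdVec_succ_apply {m : ℕ} (i k : Fin m) :
    stdVec m i.succ k = if k = i then 1 else 0 := by
  simp [stdVec, Fin.ext_iff]

theorem stdVec_nonneg {m : ℕ} (i : Fin (m + 1)) (k : Fin m) : 0 ≤ stdVec m i k := by
  unfold stdVec
  split_ifs <;> simp

theorem sum_stdVec_succ {m : ℕ} (i : Fin m) : ∑ k, stdVec m i.succ k = 1 := by
  simp [stdVec_succ_apply]

theorem sum_stdVec_le_one {m : ℕ} (i : Fin (m + 1)) : ∑ k, stdVec m i k ≤ 1 := by
  cases i using Fin.cases with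
  | zero => simp [stdVec]
  | succ i => exact (sum_stdVec_succ i).le

theorem nonneg_of_mem_cornerCone {m : ℕ} {i k : Fin m} {v : Fin m → ℤ}
    (hv : v ∈ cornerCone m i.succ) (hk : k ≠ i) : 0 ≤ v k := by
  obtain ⟨β, rfl⟩ := hv
  rw [Finset.sum_apply]
  refine Finset.sum_nonneg fun j _ => ?_
  have := stdVec_nonneg j k
  simp only [Pi.smul_apply, Pi.sub_apply, smul_eq_mul, stdVec_succ_apply, if_neg hk, sub_zero]
  positivity

theorem sum_nonpos_of_mem_cornerCone {m : ℕ} {i : Fin m} {v : Fin m → ℤ}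
    (hv : v ∈ cornerCone m i.succ) : ∑ k, v k ≤ 0 := by
  obtain ⟨β, rfl⟩ := hv
  simp only [Finset.sum_apply, Pi.smul_apply, Pi.sub_apply, smul_eq_mul]
  rw [Finset.sum_comm]
  refine Finset.sum_nonpos fun j _ => ?_
  rw [← Finset.mul_sum, Finset.sum_sub_distrib, sum_stdVec_succ]
  exact mul_nonpos_of_nonneg_of_nonpos (by positivity) (by linarith [sum_stdVec_le_one j])

theorem smul_sub_mem_cornerCone {m : ℕ} (i j : Fin (m + 1)) (β : ℕ) :
    (β : ℤ) • (stdVec m j - stdVec m i) ∈ cornerCone m i := by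
  classical
  refine ⟨Pi.single j β, ?_⟩
  rw [Finset.sum_eq_single j (fun k _ hk => by simp [Pi.single_eq_of_ne hk]) (by simp)]
  simp

/-- A lattice of dimension `d` admits at most `2 * d + 1` facets of the standard simplex whose
inequalities have no common nonzero solution in the lattice. -/
theorem exists_finset_facets {m : ℕ} (L : AddSubgroup (Fin m → ℤ))
    (hdim : Module.finrank ℝ (latticeSpan L) < m + 1) :
    ∃ S : Finset (Fin (m + 1)), S.card ≤ 2 * Module.finrank ℝ (latticeSpan L) + 1 ∧
      ∀ ℓ ∈ L, (0 ∈ S → ∑ k, ℓ k ≤ 0) → (∀ k : Fin m, k.succ ∈ S → 0 ≤ ℓ k) → ℓ = 0 := by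
  let p : Fin m → Module.Dual ℝ (latticeSpan L) := fun k =>
    (LinearMap.proj k : (Fin m → ℝ) →ₗ[ℝ] ℝ) ∘ₗ (latticeSpan L).subtype
  obtain ⟨S, hS, h⟩ := exists_finset_card_le_forall_nonneg_imp_eq_zero
    (Fin.cons (-∑ k, p k) p : Fin (m + 1) → Module.Dual ℝ (latticeSpan L))
    (by simp [Fin.sum_univ_succ]) (by simpa using hdim)
    (fun x hx => Subtype.ext (funext fun k => by simpa [p] using hx k.succ))
  refine ⟨S, hS, fun ℓ hℓ h₀ hpos => ?_⟩
  have hx := h ⟨fun k => (ℓ k : ℝ), Submodule.subset_span ⟨ℓ, hℓ, rfl⟩⟩ fun k hk => by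
    cases k using Fin.cases with
    | zero =>
      have : ((∑ k, ℓ k : ℤ) : ℝ) ≤ 0 := by exact_mod_cast h₀ hk
      simpa [p] using this
    | succ k => simpa [p] using hpos k hk
  funext k
  have := congrFun (congrArg Subtype.val hx) k
  simpa using this

theorem stmt_14 {m : ℕ} (L : AddSubgroup (Fin m → ℤ))
    (hdim : (Module.finrank ℝ ↥(latticeSpan L) : ℚ) < ((m : ℚ) - 4) / 3) :
    ∃ i j : Fin m, i ≠ j ∧
      (L : Set (Fin m → ℤ)) ∩ cornerCone m i.succ = {0} ∧
      {v | ∃ ℓ ∈ L, ∃ α : ℤ, v = ℓ + α • (stdVec m j.succ - stdVec m i.succ)}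
          ∩ cornerCone m i.succ
        = {v | ∃ β : ℕ, v = (β : ℤ) • (stdVec m j.succ - stdVec m i.succ)} := by
  set d := Module.finrank ℝ ↥(latticeSpan L)
  have hm : 3 * d + 4 < m := by
    have : (3 * d + 4 : ℚ) < m := by linarith
    exact_mod_cast this
  obtain ⟨S, hS, hL⟩ := exists_finset_facets L (by omega)
  have hcard : 1 < (Finset.univ.filter fun k : Fin m => k.succ ∉ S).card := by
    have h₁ := Finset.card_filter_add_card_filter_not (s := (Finset.univ : Finset (Fin m)))
      (fun k => k.succ ∈ S)
    have h₂ : (Finset.univ.filter fun k : Fin m => k.succ ∈ S).card ≤ S.card :=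
      Finset.card_le_card_of_injOn Fin.succ (fun k hk => by simpa using hk)
        (Fin.succ_injective m).injOn
    simp only [Finset.card_univ, Fintype.card_fin] at h₁
    omega
  obtain ⟨i, hi, j, hj, hij⟩ := Finset.one_lt_card.1 hcard
  simp only [Finset.mem_filter, Finset.mem_univ, true_and] at hi hj
  have hne : ∀ k : Fin m, k.succ ∈ S → k ≠ i ∧ k ≠ j := fun k hk =>
    ⟨fun h => hi (h ▸ hk), fun h => hj (h ▸ hk)⟩
  refine ⟨i, j, hij, ?_, ?_⟩
  · ext v
    constructor
    · rintro ⟨hv, hvC⟩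
      exact hL v hv (fun _ => sum_nonpos_of_mem_cornerCone hvC)
        fun k hk => nonneg_of_mem_cornerCone hvC (hne k hk).1
    · rintro rfl
      exact ⟨L.zero_mem, by simpa using smul_sub_mem_cornerCone i.succ i.succ 0⟩
  · ext v
    constructor
    · rintro ⟨⟨ℓ, hℓ, α, rfl⟩, hvC⟩
      have hsum := sum_nonpos_of_mem_cornerCone hvC
      have hℓ0 : ℓ = 0 := by
        refine hL ℓ hℓ (fun _ => ?_) fun k hk => ?_
        · simpa [Finset.sum_add_distrib, ← Finset.mul_sum, sum_stdVec_succ] using hsum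
        · have := nonneg_of_mem_cornerCone hvC (hne k hk).1
          simpa [stdVec_succ_apply, hne k hk] using this
      subst hℓ0
      have hα : 0 ≤ α := by
        simpa [stdVec_succ_apply, hij.symm] using nonneg_of_mem_cornerCone hvC hij.symm
      exact ⟨α.toNat, by rw [Int.toNat_of_nonneg hα, zero_add]⟩
    · rintro ⟨β, rfl⟩
      exact ⟨⟨0, L.zero_mem, β, (zero_add _).symm⟩, smul_sub_mem_cornerCone _ _ β⟩
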